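/- arXiv:1811.12547 — 2 statements merged into one kernel-verified Lean document; each statement's English description precedes it below -/
import Mathlib

section
/- If there exist sites s_{ij} ∈ V(G) for ij ∈ E(P) such that, with Σ = {s_{ij} : ij ∈ E(P)}, one has cell_G(s_{ij},Σ) = U_{ij} for every ij ∈ E(P), then there exist vertices v_i ∈ V_i for i ∈ {1,…,ℓ} such that v_i v_j ∈ E(H) for every edge ij ∈ E(P). -/
/-- Vertices of the graph `G(H,P)`: the vertices of `H` together with one vertex `w(e)` for
each edge `e` of `H`. -/
def GHPVert {V : Type*} (H : SimpleGraph V) : Type _ :=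
  V ⊕ {e : Sym2 V // e ∈ H.edgeSet}

/-- The base relation generating the edges of `G(H,P)`: each class `Vᵢ = part⁻¹(i)` is a
clique; `w(e)` is adjacent to both endpoints of `e`; and the subdivision vertices of edges
joining the same pair of classes form a clique. -/
def ghpRel {V : Type*} {ℓ : ℕ} (H : SimpleGraph V) (part : V → Fin ℓ) :
    GHPVert H → GHPVert H → Prop
  | .inl u, .inl v => part u = part v
  | .inl u, .inr e => u ∈ (e : Sym2 V)
  | .inr e, .inl u => u ∈ (e : Sym2 V)
  | .inr e, .inr f => Sym2.map part (e : Sym2 V) = Sym2.map part (f : Sym2 V)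

/-- The graph `G(H,P)` (with unit edge-lengths). -/
def ghpGraph {V : Type*} {ℓ : ℕ} (H : SimpleGraph V) (part : V → Fin ℓ) :
    SimpleGraph (GHPVert H) :=
  SimpleGraph.fromRel (ghpRel H part)

/-- The candidate Voronoi cell `U_{ij} = W_{ij} ∪ Vᵢ ∪ Vⱼ`, for the edge `ε = ij` of `P`. -/
def ghpCellSet {V : Type*} {ℓ : ℕ} (H : SimpleGraph V) (part : V → Fin ℓ)
    (ε : Sym2 (Fin ℓ)) : Set (GHPVert H) :=
  {a | (∃ u : V, a = Sum.inl u ∧ part u ∈ ε) ∨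
       (∃ e : {e : Sym2 V // e ∈ H.edgeSet}, a = Sum.inr e ∧ Sym2.map part (e : Sym2 V) = ε)}

/-- The Voronoi cell of a site `s` among the sites `Σ` in a graph with unit edge-lengths,
using the extended (ℕ∞-valued) shortest-path distance, which is `∞` across components. -/
def graphCell {V : Type*} (G : SimpleGraph V) (Sig : Set V) (s : V) : Set V :=
  {v | ∀ s' ∈ Sig, G.edist s v ≤ G.edist s' v}

/-- If some placement of sites `σ ε`, one for each edge `ε = ij` of `P`, realizes the
candidate cells `U_{ij}` as the Voronoi diagram of `G(H,P)`, then the pattern `P` is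
isomorphic to a multicolored subgraph of `H`. -/
theorem voronoi_gives_multicolored_subgraph
    {V : Type*} [Fintype V] {ℓ : ℕ} (H : SimpleGraph V) (part : V → Fin ℓ)
    (hpartsur : ∀ i, ∃ u, part u = i)
    (P : SimpleGraph (Fin ℓ))
    (hdeg : ∀ i : Fin ℓ, ∃ a b, a ≠ b ∧ P.Adj i a ∧ P.Adj i b)
    (hHP : ∀ u v : V, H.Adj u v → P.Adj (part u) (part v))
    (σ : P.edgeSet → GHPVert H)
    (hσ : ∀ ε : P.edgeSet,
      graphCell (ghpGraph H part) (Set.range σ) (σ ε) =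
        ghpCellSet H part (ε : Sym2 (Fin ℓ))) :
    ∃ v : Fin ℓ → V, (∀ i, part (v i) = i) ∧ ∀ i j, P.Adj i j → H.Adj (v i) (v j) := by
  have hself : ∀ ε : P.edgeSet, σ ε ∈ ghpCellSet H part (ε : Sym2 (Fin ℓ)) := by
    intro ε
    rw [← hσ ε]
    intro s' _
    simp
  -- every vertex of `Vᵢ` is at the same distance from all sites `σ ε` with `i ∈ ε`
  have hmem : ∀ (ε : P.edgeSet) (u : V), part u ∈ (ε : Sym2 (Fin ℓ)) → ∀ ε' : P.edgeSet,
      (ghpGraph H part).edist (σ ε) (Sum.inl u) ≤ (ghpGraph H part).edist (σ ε') (Sum.inl u) := by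
    intro ε u hu ε'
    have h : (Sum.inl u : GHPVert H) ∈ ghpCellSet H part (ε : Sym2 (Fin ℓ)) :=
      Or.inl ⟨u, rfl, hu⟩
    rw [← hσ ε] at h
    exact h _ ⟨ε', rfl⟩
  have hinl : ∀ (ε : P.edgeSet) (u : V), part u ∈ (ε : Sym2 (Fin ℓ)) → σ ε ≠ Sum.inl u := by
    intro ε u hu hs
    have key : ∀ ε' : P.edgeSet, part u ∈ (ε' : Sym2 (Fin ℓ)) → (ε' : Sym2 (Fin ℓ)) = ε := by
      intro ε' hu'
      have h1 := hmem ε' u hu' ε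
      have h0 : (ghpGraph H part).edist (σ ε) (Sum.inl u) = 0 := by
        rw [hs]; exact SimpleGraph.edist_self
      rw [h0] at h1
      have h2 : σ ε' = Sum.inl u := SimpleGraph.edist_eq_zero_iff.mp (le_antisymm h1 zero_le)
      have h3 : ghpCellSet H part (ε' : Sym2 (Fin ℓ)) = ghpCellSet H part (ε : Sym2 (Fin ℓ)) := by
        rw [← hσ, ← hσ, h2, hs]
      ext j
      obtain ⟨x, rfl⟩ := hpartsur j
      have h4 : ∀ η : Sym2 (Fin ℓ),
          (Sum.inl x : GHPVert H) ∈ ghpCellSet H part η ↔ part x ∈ η := by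
        intro η
        constructor
        · rintro (⟨y, hy, hy'⟩ | ⟨e, he, _⟩)
          · cases hy; exact hy'
          · cases he
        · intro h; exact Or.inl ⟨x, rfl, h⟩
      rw [← h4, ← h4, h3]
    obtain ⟨a, b, hab, ha, hb⟩ := hdeg (part u)
    have e1 := key ⟨s(part u, a), ha⟩ (Sym2.mem_mk_left _ _)
    have e2 := key ⟨s(part u, b), hb⟩ (Sym2.mem_mk_left _ _)
    exact hab (Sym2.congr_right.mp (e1.trans e2.symm))
  have hinr : ∀ ε : P.edgeSet, ∃ e : {e : Sym2 V // e ∈ H.edgeSet},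
      σ ε = Sum.inr e ∧ Sym2.map part (e : Sym2 V) = ε := by
    intro ε
    rcases hself ε with ⟨u, hu, hu'⟩ | h
    · exact absurd hu (hinl ε u hu')
    · exact h
  choose e he hmap using hinr
  have hv : ∀ i, ∃ v : V, part v = i ∧
      ∀ ε : P.edgeSet, i ∈ (ε : Sym2 (Fin ℓ)) → v ∈ (e ε : Sym2 V) := by
    intro i
    obtain ⟨a, b, hab, ha, hb⟩ := hdeg i
    let ε₀ : P.edgeSet := ⟨s(i, a), ha⟩
    have hi : i ∈ Sym2.map part (e ε₀ : Sym2 V) := by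
      rw [hmap]; exact Sym2.mem_mk_left _ _
    obtain ⟨v, hv, rfl⟩ := Sym2.mem_map.mp hi
    refine ⟨v, rfl, fun ε hε => ?_⟩
    have h1 := hmem ε v hε ε₀
    rw [he, he] at h1
    have hadj : (ghpGraph H part).Adj (Sum.inr (e ε₀)) (Sum.inl v) := by
      refine (SimpleGraph.fromRel_adj _ _ _).mpr ⟨?_, Or.inl hv⟩
      intro h; cases h
    rw [SimpleGraph.edist_eq_one_iff_adj.mpr hadj] at h1
    have hne : (ghpGraph H part).edist (Sum.inr (e ε)) (Sum.inl v) ≠ 0 := by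
      intro h
      have h' := SimpleGraph.edist_eq_zero_iff.mp h
      cases h'
    have h2 := SimpleGraph.edist_eq_one_iff_adj.mp
      (le_antisymm h1 (Order.one_le_iff_ne_zero.mpr hne))
    rcases ((SimpleGraph.fromRel_adj _ _ _).mp h2).2 with h | h
    · exact h
    · exact h
  choose v hv1 hv2 using hv
  refine ⟨v, hv1, fun i j hij => ?_⟩
  have hne : v i ≠ v j := by
    intro h
    apply hij.ne
    rw [← hv1 i, ← hv1 j, h]
  have hi := hv2 i ⟨s(i, j), hij⟩ (Sym2.mem_mk_left _ _)
  have hj := hv2 j ⟨s(i, j), hij⟩ (Sym2.mem_mk_right _ _)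
  have h := (e ⟨s(i, j), hij⟩).2
  rw [(Sym2.mem_and_mem_iff hne).mp ⟨hi, hj⟩] at h
  exact h
end

section
/- Suppose 0 < ε < res(I), S_i ⊆ W_i for every i ∈ {1,…,k}, and the instance I has at least one solution. Let xy be an edge of T with x ∈ W_1 and y ∈ U_1 \ W_1, and let I' be the instance obtained from I by expanding the edge xy by ε. If (s_1,…,s_k) is a solution of I', then (s_1,…,s_k) is also a solution of I. -/
namespace ExpAux

open SimpleGraph

variable {V : Type*} {T : SimpleGraph V}

lemma sublist_sum {l₁ l₂ : List ℝ} (h : l₁.Sublist l₂) (hp : ∀ r ∈ l₂, 0 < r) :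
    l₁.sum ≤ l₂.sum ∧ (l₂.sum ≤ l₁.sum → l₁ = l₂) := by
  induction h with
  | slnil => simp
  | cons a h ih =>
    have := ih (fun r hr => hp r (by simp [hr]))
    have ha := hp a (by simp)
    simp only [List.sum_cons]
    exact ⟨by linarith [this.1], fun hh => by linarith [this.1]⟩
  | cons_cons a h ih =>
    have := ih (fun r hr => hp r (by simp [hr]))
    simp only [List.sum_cons]
    refine ⟨by linarith [this.1], fun hh => ?_⟩
    rw [this.2 (by linarith)]

lemma walk_sum (w : Sym2 V → ℝ) (hw : ∀ e ∈ T.edgeSet, 0 < w e)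
    (d : V → V → ℝ)
    (hd : ∀ (u v : V) (p : T.Walk u v), p.IsPath → (p.edges.map w).sum = d u v)
    {u v : V} (p : T.Walk u v) :
    d u v ≤ (p.edges.map w).sum ∧ ((p.edges.map w).sum ≤ d u v → p.IsPath) := by
  classical
  have hb := hd u v p.bypass p.bypass_isPath
  have hs : (p.bypass.edges.map w).Sublist (p.edges.map w) :=
    p.edges_bypass_sublist_edges.map w
  have hp : ∀ r ∈ p.edges.map w, 0 < r := by
    intro r hr
    obtain ⟨e, he, rfl⟩ := List.mem_map.1 hr
    exact hw e (p.edges_subset_edgeSet he)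
  have := sublist_sum hs hp
  rw [hb] at this
  refine ⟨this.1, fun h => ?_⟩
  have h2 := congrArg List.length (this.2 h)
  simp only [List.length_map, Walk.length_edges] at h2
  have h3 := p.bypass_eq_self_of_length_le h2.ge
  rw [← h3]
  exact p.bypass_isPath

lemma exists_path (hT : T.IsTree) (u v : V) : ∃ p : T.Walk u v, p.IsPath :=
  let ⟨p, hp⟩ := (hT.connected u v).exists_isPath
  ⟨p, hp⟩

lemma path_unique (hT : T.IsTree) {u v : V} {p q : T.Walk u v} (hp : p.IsPath) (hq : q.IsPath) :
    p = q := congrArg Subtype.val (hT.isAcyclic.path_unique ⟨p, hp⟩ ⟨q, hq⟩)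

lemma tri (hT : T.IsTree) (w : Sym2 V → ℝ) (hw : ∀ e ∈ T.edgeSet, 0 < w e)
    (d : V → V → ℝ)
    (hd : ∀ (u v : V) (p : T.Walk u v), p.IsPath → (p.edges.map w).sum = d u v)
    (a c b : V) : d a b ≤ d a c + d c b := by
  obtain ⟨p, hp⟩ := exists_path hT a c
  obtain ⟨q, hq⟩ := exists_path hT c b
  have := (walk_sum w hw d hd (p.append q)).1
  simpa [hd _ _ p hp, hd _ _ q hq] using this

lemma btw_iff (hT : T.IsTree) (w : Sym2 V → ℝ) (hw : ∀ e ∈ T.edgeSet, 0 < w e)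
    (d : V → V → ℝ)
    (hd : ∀ (u v : V) (p : T.Walk u v), p.IsPath → (p.edges.map w).sum = d u v)
    {a b : V} (c : V) (p : T.Walk a b) (hp : p.IsPath) :
    c ∈ p.support ↔ d a b = d a c + d c b := by
  classical
  constructor
  · intro hc
    rw [← hd _ _ _ (hp.takeUntil hc), ← hd _ _ _ (hp.dropUntil hc), ← hd _ _ p hp]
    have h := congrArg (fun q : T.Walk a b => (q.edges.map w).sum) (p.take_spec hc)
    simp only [Walk.edges_append, List.map_append, List.sum_append] at h
    exact h.symm
  · intro h
    obtain ⟨q, hq⟩ := exists_path hT a c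
    obtain ⟨r, hr⟩ := exists_path hT c b
    have := (walk_sum w hw d hd (q.append r)).2
      (by simp [hd _ _ q hq, hd _ _ r hr, h])
    rw [path_unique hT hp this]
    simp

lemma symm_d (hT : T.IsTree) (w : Sym2 V → ℝ)
    (d : V → V → ℝ)
    (hd : ∀ (u v : V) (p : T.Walk u v), p.IsPath → (p.edges.map w).sum = d u v)
    (a b : V) : d a b = d b a := by
  obtain ⟨p, hp⟩ := exists_path hT a b
  rw [← hd _ _ p hp, ← hd _ _ _ hp.reverse]
  simp

lemma btw3 (hT : T.IsTree) (w : Sym2 V → ℝ) (hw : ∀ e ∈ T.edgeSet, 0 < w e)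
    (d : V → V → ℝ)
    (hd : ∀ (u v : V) (p : T.Walk u v), p.IsPath → (p.edges.map w).sum = d u v)
    (a b c s : V) (h : d a b = d a c + d c b) :
    d a s = d a c + d c s ∨ d s b = d s c + d c b := by
  classical
  obtain ⟨p, hp⟩ := exists_path hT a s
  obtain ⟨q, hq⟩ := exists_path hT s b
  have h1 := (btw_iff hT w hw d hd c _ (p.append q).bypass_isPath).2 h
  have h2 := (p.append q).support_bypass_subset h1
  rw [Walk.mem_support_append_iff] at h2
  exact h2.imp (btw_iff hT w hw d hd c p hp).1 (btw_iff hT w hw d hd c q hq).1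

/-- lifting a path to the subdivided tree -/
lemma lift_path {x y : V} (w : Sym2 V → ℝ) (ε : ℝ)
    (T' : SimpleGraph (V ⊕ Unit))
    (hT'adj : ∀ a b : V ⊕ Unit, T'.Adj a b ↔
      ((∃ u v : V, a = Sum.inl u ∧ b = Sum.inl v ∧ T.Adj u v ∧ s(u, v) ≠ s(x, y)) ∨
        (a = Sum.inl x ∧ b = Sum.inr ()) ∨ (a = Sum.inr () ∧ b = Sum.inl x) ∨
        (a = Sum.inl y ∧ b = Sum.inr ()) ∨ (a = Sum.inr () ∧ b = Sum.inl y)))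
    (w' : Sym2 (V ⊕ Unit) → ℝ)
    (hw'old : ∀ u v : V, w' s(Sum.inl u, Sum.inl v) = w s(u, v))
    (hw'x : w' s(Sum.inl x, Sum.inr ()) = w s(x, y))
    (hw'y : w' s(Sum.inl y, Sum.inr ()) = ε)
    {a b : V} (p : T.Walk a b) (hp : p.IsPath) :
    ∃ q : T'.Walk (Sum.inl a) (Sum.inl b), q.IsPath ∧
      (∀ v, Sum.inl v ∈ q.support → v ∈ p.support) ∧
      (Sum.inr () ∈ q.support → s(x, y) ∈ p.edges) ∧
      (s(x, y) ∉ p.edges → (q.edges.map w').sum = (p.edges.map w).sum) ∧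
      (s(x, y) ∈ p.edges → (q.edges.map w').sum = (p.edges.map w).sum + ε) := by
  induction p with
  | nil => exact ⟨Walk.nil, by simp, by simp, by simp, by simp, by simp⟩
  | @cons a c b h p ih =>
    rw [Walk.cons_isPath_iff] at hp
    obtain ⟨q, hq, h1, h2, h3, h4⟩ := ih hp.1
    by_cases he : s(x, y) = s(a, c)
    · have hne : s(x, y) ∉ p.edges := by
        rw [he]
        intro hmem
        exact hp.2 (p.fst_mem_support_of_mem_edges hmem)
      have hr : Sum.inr () ∉ q.support := fun hh => hne (h2 hh)
      have hl : Sum.inl a ∉ q.support := fun hh => hp.2 (h1 _ hh)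
      have key : T'.Adj (Sum.inl a) (Sum.inr ()) ∧ T'.Adj (Sum.inr ()) (Sum.inl c) ∧
          w' s(Sum.inl a, Sum.inr ()) + w' s(Sum.inr (), Sum.inl c) = w s(a, c) + ε := by
        rw [hT'adj, hT'adj, Sym2.eq_swap (a := Sum.inr ())]
        rcases Sym2.eq_iff.1 he with ⟨rfl, rfl⟩ | ⟨rfl, rfl⟩
        · refine ⟨by simp, by simp, by rw [hw'x, hw'y]⟩
        · refine ⟨by simp, by simp, by rw [hw'x, hw'y, he]; ring⟩
      obtain ⟨k1, k2, k3⟩ := key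
      refine ⟨Walk.cons k1 (Walk.cons k2 q), ?_, ?_, ?_, ?_, ?_⟩
      · simp [Walk.cons_isPath_iff, hq, hr, hl]
      · intro v hv
        simp only [Walk.support_cons, List.mem_cons, Sum.inl.injEq, reduceCtorEq, false_or] at hv ⊢
        exact hv.imp id (h1 v)
      · intro _; simp [he]
      · intro hh; simp [he] at hh
      · intro _
        simp only [Walk.edges_cons, List.map_cons, List.sum_cons, h3 hne]
        linarith
    · have k1 : T'.Adj (Sum.inl a) (Sum.inl c) :=
        (hT'adj _ _).2 (Or.inl ⟨a, c, rfl, rfl, h, fun hh => he hh.symm⟩)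
      have hl : Sum.inl a ∉ q.support := fun hh => hp.2 (h1 _ hh)
      refine ⟨Walk.cons k1 q, ?_, ?_, ?_, ?_, ?_⟩
      · simp [Walk.cons_isPath_iff, hq, hl]
      · intro v hv
        simp only [Walk.support_cons, List.mem_cons, Sum.inl.injEq] at hv ⊢
        exact hv.imp id (h1 v)
      · intro hv
        simp only [Walk.support_cons, List.mem_cons, reduceCtorEq, false_or] at hv
        simp [h2 hv]
      · intro hh
        simp only [Walk.edges_cons, List.mem_cons, not_or] at hh
        simp [h3 hh.2, hw'old]
      · intro hh
        simp only [Walk.edges_cons, List.mem_cons, he, false_or] at hh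
        simp [h4 hh, hw'old, add_assoc]

/-- sides of the edge `xy` -/
lemma sides (hT : T.IsTree) {x y : V} (hxy : T.Adj x y) : ∃ A : V → Prop, A x ∧ ¬ A y ∧
    ∀ (a b : V) (p : T.Walk a b), p.IsPath → (s(x, y) ∈ p.edges ↔ ¬ (A a ↔ A b)) := by
  classical
  have hbr : ¬ (T.deleteEdges {s(x, y)}).Reachable x y :=
    (isBridge_iff.1 (isAcyclic_iff_forall_edge_isBridge.1 hT.isAcyclic hxy))
  -- a path avoiding the edge gives reachability
  have hav : ∀ (a b : V) (p : T.Walk a b), s(x, y) ∉ p.edges →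
      (T.deleteEdges {s(x, y)}).Reachable a b := by
    intro a b p hp
    exact ⟨p.toDeleteEdge _ hp⟩
  have hre : ∀ (a b : V) (p : T.Walk a b), p.IsPath →
      (T.deleteEdges {s(x, y)}).Reachable a b → s(x, y) ∉ p.edges := by
    intro a b p hp hr hmem
    obtain ⟨q, hq⟩ := hr.exists_isPath
    have hle : T.deleteEdges {s(x, y)} ≤ T := deleteEdges_le _
    rw [path_unique hT hp (hq.mapLe hle)] at hmem
    rw [Walk.edges_mapLe_eq_edges] at hmem
    have := q.edges_subset_edgeSet hmem
    simp at this
  have hor : ∀ a, (T.deleteEdges {s(x, y)}).Reachable a x ∨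
      (T.deleteEdges {s(x, y)}).Reachable a y := by
    intro a
    obtain ⟨p, hp⟩ := exists_path hT a x
    by_cases hm : s(x, y) ∈ p.edges
    · right
      have hy : y ∈ p.support := p.snd_mem_support_of_mem_edges hm
      refine hav _ _ (p.takeUntil y hy) ?_
      intro hm2
      have hx2 := (p.takeUntil y hy).fst_mem_support_of_mem_edges hm2
      exact Walk.endpoint_notMem_support_takeUntil hp hy hxy.ne hx2
    · exact Or.inl (hav _ _ p hm)
  refine ⟨fun a => (T.deleteEdges {s(x, y)}).Reachable a x, Reachable.refl _,
    fun h => hbr h.symm, ?_⟩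
  intro a b p hp
  have h1 : s(x, y) ∉ p.edges ↔ (T.deleteEdges {s(x, y)}).Reachable a b :=
    ⟨hav _ _ p, hre _ _ p hp⟩
  rw [← not_iff_not, h1, not_not]
  constructor
  · intro h
    exact ⟨fun h2 => h.symm.trans h2, fun h2 => h.trans h2⟩
  · intro h
    by_cases ha : (T.deleteEdges {s(x, y)}).Reachable a x
    · exact ha.trans (h.1 ha).symm
    · have hb := mt h.2 ha
      exact ((hor a).resolve_left ha).trans ((hor b).resolve_left hb).symm

end ExpAux

/-- Expanding an edge `xy` (with `x ∈ W₁`, `y ∈ U₁ \ W₁`) of a tree instance of the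
Generalized Graphic Inverse Voronoi problem by `ε` with `0 < ε < res(I)`: if moreover
`S i ⊆ W i` for every `i` and the original instance `I` has some solution, then any
solution of the expanded instance `I'` is also a solution of `I`.

The expanded tree `T'` lives on `V ⊕ Unit`, where `Sum.inr ()` is the subdivision vertex
`y'`; the edge `xy'` keeps the length of `xy` and the new edge `yy'` has length `ε`.
`U'₁` consists of `y'` together with the vertices of `U₁` in the component of `T − y`
containing `x` (those `u` whose path to `x` avoids `y`); all other data is unchanged.
The condition `ε < res(I)` is expressed by: every positive difference
`d(sᵢ,u) − d(sⱼ,u)` with `u ∈ Uᵢ ∩ Uⱼ`, `sᵢ ∈ Sᵢ`, `sⱼ ∈ Sⱼ` exceeds `ε`. -/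
theorem expansion_reflects_solution
    {V : Type*} [Fintype V] (T : SimpleGraph V) (hT : T.IsTree)
    (w : Sym2 V → ℝ) (hw : ∀ e ∈ T.edgeSet, 0 < w e)
    (d : V → V → ℝ)
    (hd : ∀ (u v : V) (p : T.Walk u v), p.IsPath → (p.edges.map w).sum = d u v)
    (k : ℕ) (U S : Fin k → Set V)
    (hcover : (⋃ i, U i) = Set.univ)
    (hSW : ∀ i, S i ⊆ U i \ ⋃ (j) (_ : j ≠ i), U j)
    (i₀ : Fin k) (x y : V) (hxy : T.Adj x y)
    (hx : x ∈ U i₀ \ ⋃ (j) (_ : j ≠ i₀), U j)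
    (hyU : y ∈ U i₀) (hyW : y ∉ U i₀ \ ⋃ (j) (_ : j ≠ i₀), U j)
    (ε : ℝ) (hε : 0 < ε)
    (hres : ∀ (i j : Fin k) (u si sj : V), u ∈ U i → u ∈ U j → si ∈ S i → sj ∈ S j →
      0 < d si u - d sj u → ε < d si u - d sj u)
    -- the original instance has some solution
    (hsol : ∃ t : Fin k → V, ∀ i, t i ∈ S i ∧ {v | ∀ j, d (t i) v ≤ d (t j) v} = U i)
    -- the expanded tree `T'`
    (T' : SimpleGraph (V ⊕ Unit))
    (hT'adj : ∀ a b : V ⊕ Unit, T'.Adj a b ↔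
      ((∃ u v : V, a = Sum.inl u ∧ b = Sum.inl v ∧ T.Adj u v ∧ s(u, v) ≠ s(x, y)) ∨
        (a = Sum.inl x ∧ b = Sum.inr ()) ∨ (a = Sum.inr () ∧ b = Sum.inl x) ∨
        (a = Sum.inl y ∧ b = Sum.inr ()) ∨ (a = Sum.inr () ∧ b = Sum.inl y)))
    -- its edge-lengths
    (w' : Sym2 (V ⊕ Unit) → ℝ)
    (hw'old : ∀ u v : V, w' s(Sum.inl u, Sum.inl v) = w s(u, v))
    (hw'x : w' s(Sum.inl x, Sum.inr ()) = w s(x, y))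
    (hw'y : w' s(Sum.inl y, Sum.inr ()) = ε)
    -- its tree distance
    (d' : V ⊕ Unit → V ⊕ Unit → ℝ)
    (hd' : ∀ (a b : V ⊕ Unit) (p : T'.Walk a b), p.IsPath → (p.edges.map w').sum = d' a b)
    -- the modified cell `U'₁`
    (U₁' : Set (V ⊕ Unit))
    (hU₁' : U₁' = {Sum.inr ()} ∪
      Sum.inl '' {u | u ∈ U i₀ ∧ ∀ p : T.Walk u x, p.IsPath → y ∉ p.support})
    -- a solution of the expanded instance `I'`
    (st : Fin k → V)
    (hsol' : ∀ i, (Sum.inl (st i) : V ⊕ Unit) ∈ (Sum.inl '' S i : Set (V ⊕ Unit)) ∧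
      {a : V ⊕ Unit | ∀ j, d' (Sum.inl (st i)) a ≤ d' (Sum.inl (st j)) a} =
        (if i = i₀ then U₁' else (Sum.inl '' U i : Set (V ⊕ Unit)))) :
    ∀ i, st i ∈ S i ∧ {v | ∀ j, d (st i) v ≤ d (st j) v} = U i := by
  classical
  obtain ⟨t, ht⟩ := hsol
  have symm := ExpAux.symm_d hT w d hd
  have tri := ExpAux.tri hT w hw d hd
  have btw3 := ExpAux.btw3 hT w hw d hd
  have hdself : ∀ a, d a a = 0 := fun a => by
    rw [← hd a a SimpleGraph.Walk.nil (by simp)]; simp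
  have hdxy : d x y = w s(x, y) := by
    rw [← hd x y hxy.toWalk (by simp [hxy.ne])]; simp
  have hwpos : 0 < d x y := by rw [hdxy]; exact hw _ hxy
  have hdnn : ∀ a b, 0 ≤ d a b := fun a b => by
    have := tri a b a
    rw [hdself, symm b a] at this
    linarith
  obtain ⟨A, hAx, hAy, hA⟩ := ExpAux.sides hT hxy
  -- crossing
  have crossx : ∀ a b, ¬ (A a ↔ A b) → d a b = d a x + d x b := by
    intro a b hab
    obtain ⟨p, hp⟩ := ExpAux.exists_path hT a b
    exact (ExpAux.btw_iff hT w hw d hd x p hp).1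
      (p.fst_mem_support_of_mem_edges ((hA a b p hp).2 hab))
  have crossy : ∀ a b, ¬ (A a ↔ A b) → d a b = d a y + d y b := by
    intro a b hab
    obtain ⟨p, hp⟩ := ExpAux.exists_path hT a b
    exact (ExpAux.btw_iff hT w hw d hd y p hp).1
      (p.snd_mem_support_of_mem_edges ((hA a b p hp).2 hab))
  have hlift := fun {a b : V} (p : T.Walk a b) (hp : p.IsPath) =>
    ExpAux.lift_path (x := x) (y := y) w ε T' hT'adj w' hw'old hw'x hw'y p hp
  have dsame : ∀ a b, (A a ↔ A b) → d' (Sum.inl a) (Sum.inl b) = d a b := by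
    intro a b hab
    obtain ⟨p, hp⟩ := ExpAux.exists_path hT a b
    obtain ⟨q, hq, -, -, h3, -⟩ := hlift p hp
    rw [← hd' _ _ q hq, ← hd _ _ p hp]
    exact h3 (fun hm => (hA a b p hp).1 hm hab)
  have ddiff : ∀ a b, ¬ (A a ↔ A b) → d' (Sum.inl a) (Sum.inl b) = d a b + ε := by
    intro a b hab
    obtain ⟨p, hp⟩ := ExpAux.exists_path hT a b
    obtain ⟨q, hq, -, -, -, h4⟩ := hlift p hp
    rw [← hd' _ _ q hq, ← hd _ _ p hp]
    exact h4 ((hA a b p hp).2 hab)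
  have dyA : ∀ a, A a → d' (Sum.inl a) (Sum.inr ()) = d a y := by
    intro a ha
    obtain ⟨p, hp⟩ := ExpAux.exists_path hT a x
    obtain ⟨q, hq, -, h2, h3, -⟩ := hlift p hp
    have hn : s(x, y) ∉ p.edges := fun hm => (hA a x p hp).1 hm (by simp [ha, hAx])
    have hadj : T'.Adj (Sum.inl x) (Sum.inr ()) := by rw [hT'adj]; simp
    rw [← hd' _ _ (q.concat hadj) (hq.concat (fun hm => hn (h2 hm)) hadj),
      crossx a y (by simp [ha, hAy]), ← hd _ _ p hp, hdxy]
    simp [SimpleGraph.Walk.edges_concat, h3 hn, hw'x]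
  have dyB : ∀ a, ¬ A a → d' (Sum.inl a) (Sum.inr ()) = d a y + ε := by
    intro a ha
    obtain ⟨p, hp⟩ := ExpAux.exists_path hT a y
    obtain ⟨q, hq, -, h2, h3, -⟩ := hlift p hp
    have hn : s(x, y) ∉ p.edges := fun hm => (hA a y p hp).1 hm (by simp [ha, hAy])
    have hadj : T'.Adj (Sum.inl y) (Sum.inr ()) := by rw [hT'adj]; simp
    rw [← hd' _ _ (q.concat hadj) (hq.concat (fun hm => hn (h2 hm)) hadj), ← hd _ _ p hp]
    simp [SimpleGraph.Walk.edges_concat, h3 hn, hw'y]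
  have hcond : ∀ u, (∀ p : T.Walk u x, p.IsPath → y ∉ p.support) ↔ A u := by
    intro u
    constructor
    · intro h
      by_contra hu
      obtain ⟨p, hp⟩ := ExpAux.exists_path hT u x
      exact h p hp (p.snd_mem_support_of_mem_edges ((hA u x p hp).2 (by simp [hu, hAx])))
    · intro hu p hp hm
      have h1 := (ExpAux.btw_iff hT w hw d hd y p hp).1 hm
      have h2 := crossx u y (by simp [hu, hAy])
      have := symm x y
      linarith
  -- membership in cells
  have htU : ∀ i v, v ∈ U i ↔ ∀ j, d (t i) v ≤ d (t j) v := by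
    intro i v; rw [← (ht i).2]; rfl
  have hsS : ∀ i, st i ∈ S i := by
    intro i
    obtain ⟨z, hz, hze⟩ := (hsol' i).1
    rwa [← Sum.inl.inj hze]
  have hs1 : ∀ a, (∀ j, d' (Sum.inl (st i₀)) a ≤ d' (Sum.inl (st j)) a) ↔ a ∈ U₁' := by
    intro a
    have := (hsol' i₀).2
    rw [if_pos rfl] at this
    rw [← this]; rfl
  have hs1v : ∀ v, (∀ j, d' (Sum.inl (st i₀)) (Sum.inl v) ≤ d' (Sum.inl (st j)) (Sum.inl v)) ↔
      v ∈ U i₀ ∧ A v := by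
    intro v
    rw [hs1, hU₁']
    simp [hcond]
  have hsi : ∀ i, i ≠ i₀ → ∀ a, (∀ j, d' (Sum.inl (st i)) a ≤ d' (Sum.inl (st j)) a) ↔
      a ∈ (Sum.inl '' U i : Set (V ⊕ Unit)) := by
    intro i hi a
    have := (hsol' i).2
    rw [if_neg hi] at this
    rw [← this]; rfl
  have hsiv : ∀ i, i ≠ i₀ → ∀ v,
      (∀ j, d' (Sum.inl (st i)) (Sum.inl v) ≤ d' (Sum.inl (st j)) (Sum.inl v)) ↔ v ∈ U i := by
    intro i hi v
    rw [hsi i hi]; simp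
  have hW : ∀ i j v, j ≠ i → v ∈ S i → v ∉ U j := by
    intro i j v hji hv hvj
    exact (hSW i hv).2 (Set.mem_iUnion₂.2 ⟨j, hji, hvj⟩)
  have hxW : ∀ j, j ≠ i₀ → x ∉ U j := fun j hj hxj =>
    hx.2 (Set.mem_iUnion₂.2 ⟨j, hj, hxj⟩)
  -- an index `j₀ ≠ i₀` with `y ∈ U j₀`
  obtain ⟨j₀, hj₀, hyj₀⟩ : ∃ j, j ≠ i₀ ∧ y ∈ U j := by
    by_contra hcon
    push Not at hcon
    refine hyW ⟨hyU, fun hm => ?_⟩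
    obtain ⟨j, hj, hyj⟩ := Set.mem_iUnion₂.1 hm
    exact hcon j hj hyj
  -- `t i₀` is on the side of `x`
  have htA : A (t i₀) := by
    by_contra hn
    apply hxW j₀ hj₀
    rw [htU]
    intro j
    have h1 := crossy (t i₀) x (by simp [hn, hAx])
    have h2 := (htU j₀ y).1 hyj₀ i₀
    have h3 := tri (t j₀) y x
    have h4 := (htU i₀ x).1 hx.1 j
    linarith
  have hty : d (t i₀) y = d (t j₀) y :=
    le_antisymm ((htU i₀ y).1 hyU j₀) ((htU j₀ y).1 hyj₀ i₀)
  have hsA : A (st i₀) := by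
    have : st i₀ ∈ U i₀ ∧ A (st i₀) := by
      rw [← hs1v]
      intro j
      rw [dsame _ _ Iff.rfl, hdself]
      by_cases hab : A (st j) ↔ A (st i₀)
      · rw [dsame _ _ hab]; exact hdnn _ _
      · rw [ddiff _ _ hab]; linarith [hdnn (st j) (st i₀)]
    exact this.2
  -- at the subdivision vertex
  have hy'1 : ∀ j, j ≠ i₀ → d (st i₀) y < d' (Sum.inl (st j)) (Sum.inr ()) := by
    intro j hj
    by_contra hcon
    push Not at hcon
    have h1 := (hs1 (Sum.inr ())).2 (by rw [hU₁']; simp)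
    have : (Sum.inr () : V ⊕ Unit) ∈ (Sum.inl '' U j : Set (V ⊕ Unit)) := by
      rw [← hsi j hj]
      intro l
      have := h1 l
      rw [dyA _ hsA] at this
      linarith
    simp at this
  have hsB : ∀ j, j ≠ i₀ → y ∈ U j → ¬ A (st j) := by
    intro j hj hyj hAj
    have h1 := (hsiv j hj y).2 hyj i₀
    rw [ddiff _ _ (by simp [hAj, hAy]), ddiff _ _ (by simp [hsA, hAy])] at h1
    have h2 := hy'1 j hj
    rw [dyA _ hAj] at h2
    linarith
  have hB0 := hsB j₀ hj₀ hyj₀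
  have hD : d (st i₀) y = d (st j₀) y := by
    have h1 := hy'1 j₀ hj₀
    rw [dyB _ hB0] at h1
    have h2 : d (st j₀) y < d (st i₀) y + ε := by
      by_contra hcon
      push Not at hcon
      have : y ∈ U i₀ ∧ A y := by
        rw [← hs1v]
        intro l
        have h3 := (hsiv j₀ hj₀ y).2 hyj₀ l
        rw [dsame _ _ (by simp [hB0, hAy])] at h3
        rw [ddiff _ _ (by simp [hsA, hAy])]
        linarith
      exact hAy this.2
    rcases lt_trichotomy (d (st i₀) y) (d (st j₀) y) with h | h | h
    · have := hres j₀ i₀ y _ _ hyj₀ hyU (hsS j₀) (hsS i₀) (by linarith)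
      linarith
    · exact h
    · have := hres i₀ j₀ y _ _ hyU hyj₀ (hsS i₀) (hsS j₀) (by linarith)
      linarith
  have hDle : ∀ j, d (st i₀) y ≤ d (st j) y := by
    intro j
    by_cases hj : j = i₀
    · rw [hj]
    by_cases hAj : A (st j)
    · have := hy'1 j hj
      rw [dyA _ hAj] at this
      exact this.le
    · have := (hsiv j₀ hj₀ y).2 hyj₀ j
      rw [dsame _ _ (by simp [hB0, hAy]), dsame _ _ (by simp [hAj, hAy])] at this
      linarith
  have hDlt : ∀ j, j ≠ i₀ → A (st j) → d (st i₀) y < d (st j) y := by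
    intro j hj hAj
    have := hy'1 j hj
    rwa [dyA _ hAj] at this
  -- `y` is not between `t j₀` and `st j₀`
  have hnb : d (t j₀) (st j₀) ≠ d (t j₀) y + d y (st j₀) := by
    intro h
    apply hW j₀ i₀ (st j₀) hj₀.symm (hsS j₀)
    rw [htU]
    intro j
    have h1 := (htU j₀ (st j₀)).1 (hSW j₀ (hsS j₀)).1 j
    have h2 := tri (t i₀) y (st j₀)
    linarith
  -- main argument
  intro i
  refine ⟨hsS i, ?_⟩
  ext v
  simp only [Set.mem_setOf_eq]
  by_cases hv : A v
  · -- the side of x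
    have hlt : ∀ j, ¬ A (st j) → d (st i₀) v < d (st j) v := by
      intro j hj
      have h1 := crossy (st j) v (by simp [hj, hv])
      have h2 := crossx y v (by simp [hAy, hv])
      have h3 := crossx (st i₀) y (by simp [hsA, hAy])
      have h4 := tri (st i₀) x v
      have h5 := hDle j
      have h6 := symm x y
      linarith
    have hU : (∀ j, d' (Sum.inl (st i)) (Sum.inl v) ≤ d' (Sum.inl (st j)) (Sum.inl v)) ↔
        v ∈ U i := by
      by_cases hi : i = i₀
      · subst hi; rw [hs1v]; simp [hv]
      · exact hsiv i hi v
    rw [← hU]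
    have e1 : ∀ j, A (st j) → d' (Sum.inl (st j)) (Sum.inl v) = d (st j) v :=
      fun j hj => dsame _ _ (by simp [hj, hv])
    have e2 : ∀ j, ¬ A (st j) → d' (Sum.inl (st j)) (Sum.inl v) = d (st j) v + ε :=
      fun j hj => ddiff _ _ (by simp [hj, hv])
    by_cases hi : A (st i)
    · constructor
      · intro h j
        rw [e1 i hi]
        by_cases hj : A (st j)
        · rw [e1 j hj]; exact h j
        · rw [e2 j hj]; linarith [h j]
      · intro h j
        by_cases hj : A (st j)
        · have := h j
          rwa [e1 i hi, e1 j hj] at this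
        · have := h i₀
          rw [e1 i hi, e1 i₀ hsA] at this
          linarith [hlt j hj]
    · constructor
      · intro h; linarith [h i₀, hlt i hi]
      · intro h
        have := h i₀
        rw [e2 i hi, e1 i₀ hsA] at this
        linarith [hlt i hi]
  · -- the side of y
    have e1 : ∀ j, A (st j) → d' (Sum.inl (st j)) (Sum.inl v) = d (st j) v + ε :=
      fun j hj => ddiff _ _ (by simp [hj, hv])
    have e2 : ∀ j, ¬ A (st j) → d' (Sum.inl (st j)) (Sum.inl v) = d (st j) v :=
      fun j hj => dsame _ _ (by simp [hj, hv])
    have hle : ∀ j, A (st j) → d (st j₀) v ≤ d (st j) v := by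
      intro j hj
      have h1 := crossy (st j) v (by simp [hj, hv])
      have h2 := tri (st j₀) y v
      linarith [hDle j]
    by_cases hi : i = i₀
    · subst hi
      have c1 := crossy (st i) v (by simp [hsA, hv])
      have c2 := crossy (t i) v (by simp [htA, hv])
      have c3 := tri (st j₀) y v
      have c4 := tri (t j₀) y v
      constructor
      · intro h
        have h1 : d (st j₀) v = d (st j₀) y + d y v := by linarith [h j₀]
        have h2 : v ∈ U j₀ := by
          rw [← hsiv j₀ hj₀]
          intro j
          rw [e2 j₀ hB0]
          by_cases hj : A (st j)
          · rw [e1 j hj]; linarith [h j]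
          · rw [e2 j hj]; linarith [h j]
        rcases btw3 _ _ y (t j₀) h1 with h3 | h3
        · exfalso
          apply hnb
          rw [symm, h3, symm y (t j₀), symm (st j₀) y, add_comm]
        · rw [htU]
          intro j
          have := (htU j₀ v).1 h2 j
          linarith
      · intro h j
        have h0 := (htU i v).1 h
        have h1 : d (t j₀) v = d (t j₀) y + d y v := by linarith [h0 j₀]
        have h2 : v ∈ U j₀ := by
          rw [htU]
          intro j
          linarith [h0 j]
        rcases btw3 _ _ y (st j₀) h1 with h3 | h3
        · exact absurd h3 hnb
        · by_cases hj : A (st j)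
          · linarith [hle j hj, hD]
          · have := (hsiv j₀ hj₀ v).2 h2 j
            rw [e2 j₀ hB0, e2 j hj] at this
            linarith
    · rw [← hsiv i hi v]
      by_cases hAi : A (st i)
      · have c1 := crossy (st i) v (by simp [hAi, hv])
        have c3 := tri (st j₀) y v
        have c5 := hDlt i hi hAi
        constructor
        · intro h; linarith [h j₀]
        · intro h
          have := h j₀
          rw [e1 i hAi, e2 j₀ hB0] at this
          linarith
      · constructor
        · intro h j
          rw [e2 i hAi]
          by_cases hj : A (st j)
          · rw [e1 j hj]; linarith [h j]
          · rw [e2 j hj]; exact h j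
        · intro h j
          by_cases hj : A (st j)
          · have := h j₀
            rw [e2 i hAi, e2 j₀ hB0] at this
            linarith [hle j hj]
          · have := h j
            rwa [e2 i hAi, e2 j hj] at this
end
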